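/- Let g = g₀ ⊕ g₁ be a non-degenerate filiform Lie superalgebra over ℂ with dim g₀ = 4 and dim g₁ = m ≥ 5. If g is naturally graded, then g is isomorphic to exactly one of the following two non-isomorphic Lie superalgebras on a basis {X₀,X₁,X₂,X₃,Y₁,…,Y_m}, where in both [X₀,X_i] = X_{i+1} for 1 ≤ i ≤ 2, [X₀,Y_j] = Y_{j+1} for 1 ≤ j ≤ m−1, (Y₁,Y₁) = X₂ and (Y₁,Y₂) = (1/2)X₃: (I) no further nonzero products; (II) additionally [X₁,Y_j] = Y_{j+1} for 1 ≤ j ≤ m−1. -/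

import Mathlib

/-- The sign `(-1)^(i·j)` for parities `i j : ZMod 2`, as a complex scalar. -/
def ssign (i j : ZMod 2) : ℂ := if i = 1 ∧ j = 1 then -1 else 1

/-- A (complex) Lie superalgebra structure on the vector space `V`: a ℤ₂-grading
`g` whose parts are complementary, together with an even bilinear bracket which is
super skew-symmetric and satisfies the super Jacobi identity on homogeneous elements. -/
structure LieSuperAlg (V : Type*) [AddCommGroup V] [Module ℂ V] where
  g : ZMod 2 → Submodule ℂ V
  bk : V →ₗ[ℂ] V →ₗ[ℂ] V
  compl : IsCompl (g 0) (g 1)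
  grading : ∀ i j : ZMod 2, ∀ x ∈ g i, ∀ y ∈ g j, bk x y ∈ g (i + j)
  skew : ∀ i j : ZMod 2, ∀ x ∈ g i, ∀ y ∈ g j, bk x y = -(ssign i j • bk y x)
  jacobi : ∀ i j k : ZMod 2, ∀ x ∈ g i, ∀ y ∈ g j, ∀ z ∈ g k,
    ssign k i • bk x (bk y z) + ssign i j • bk y (bk z x) + ssign j k • bk z (bk x y) = 0

namespace LieSuperAlg

variable {V : Type*} [AddCommGroup V] [Module ℂ V]

/-- The descending sequences `C⁰(g_i) = g_i`, `C^{k+1}(g_i) = [g₀, C^k(g_i)]`. -/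
def C (A : LieSuperAlg V) (i : ZMod 2) : ℕ → Submodule ℂ V
  | 0 => A.g i
  | k + 1 => Submodule.span ℂ {z | ∃ x ∈ A.g 0, ∃ y ∈ C A i k, z = A.bk x y}

/-- The descending central sequence of the whole superalgebra. -/
def DC (A : LieSuperAlg V) : ℕ → Submodule ℂ V
  | 0 => ⊤
  | k + 1 => Submodule.span ℂ {z | ∃ x ∈ DC A k, ∃ y : V, z = A.bk x y}

/-- Nilpotency: the descending central sequence reaches zero. -/
def IsNilpotent (A : LieSuperAlg V) : Prop := ∃ k, A.DC k = ⊥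

/-- `A` is filiform with parameters `(n, m)`: it is nilpotent, `dim g₀ = n + 1`,
`dim g₁ = m`, and the super-nilindex is `(n, m)` (the maximal one). -/
def IsFiliform (A : LieSuperAlg V) (n m : ℕ) : Prop :=
  A.IsNilpotent ∧ Module.finrank ℂ (A.g 0) = n + 1 ∧ Module.finrank ℂ (A.g 1) = m ∧
    A.C 0 (n - 1) ≠ ⊥ ∧ A.C 1 (m - 1) ≠ ⊥ ∧ A.C 0 n = ⊥ ∧ A.C 1 m = ⊥

/-- Non-degeneracy: the bracket does not vanish identically on `g₁ × g₁`. -/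
def NonDegenerate (A : LieSuperAlg V) : Prop :=
  ∃ x ∈ A.g 1, ∃ y ∈ A.g 1, A.bk x y ≠ 0

/-- `A` is naturally graded: there are subspaces `W a i` (`i ≥ 1`, parity `a`), splitting
the filtrations `C` (so that `W a i ≅ C^{i-1}(g_a)/C^i(g_a)` and `g ≅ gr(g)` in the
natural way) and compatible with the bracket (so `gr(g)` is a graded Lie superalgebra,
`[gⁱ, gʲ] ⊆ g^{i+j}`).  For finite-dimensional nilpotent superalgebras this is
equivalent to the textbook definition `g ≅ gr(g)` with `gr(g)` graded. -/
def NaturallyGraded (A : LieSuperAlg V) : Prop :=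
  ∃ W : ZMod 2 → ℕ → Submodule ℂ V,
    (∀ a, W a 0 = ⊥) ∧
    (∀ a k, A.C a k = W a (k + 1) ⊔ A.C a (k + 1)) ∧
    (∀ a k, W a (k + 1) ⊓ A.C a (k + 1) = ⊥) ∧
    (∀ a b : ZMod 2, ∀ i j : ℕ, ∀ x ∈ W a i, ∀ y ∈ W b j, A.bk x y ∈ W (a + b) (i + j))

/-- `X 0, …, X n` and `Y 1, …, Y m` form an adapted basis of the superalgebra:
the `X i` are even, the `Y j` are odd, and together they form a basis of `V`. -/
def IsAdaptedBasis (A : LieSuperAlg V) (n m : ℕ) (X Y : ℕ → V) : Prop :=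
  (∀ i, i ≤ n → X i ∈ A.g 0) ∧ (∀ j, 1 ≤ j → j ≤ m → Y j ∈ A.g 1) ∧
  LinearIndependent ℂ
    (Sum.elim (fun i : Fin (n + 1) => X i.val) (fun j : Fin m => Y (j.val + 1))) ∧
  Submodule.span ℂ
    (Set.range (Sum.elim (fun i : Fin (n + 1) => X i.val) (fun j : Fin m => Y (j.val + 1)))) = ⊤

end LieSuperAlg

/-- The law `L^{3,m} + φ₁₂`. -/
def Law3mI {V : Type*} [AddCommGroup V] [Module ℂ V] (A : LieSuperAlg V) (m : ℕ) : Prop :=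
  ∃ X Y : ℕ → V, A.IsAdaptedBasis 3 m X Y ∧
    (∀ i j : ℕ, i ≤ 3 → j ≤ 3 → A.bk (X i) (X j) =
      if i = 0 ∧ 1 ≤ j ∧ j ≤ 2 then X (j + 1)
      else if j = 0 ∧ 1 ≤ i ∧ i ≤ 2 then -X (i + 1) else 0) ∧
    (∀ i j : ℕ, i ≤ 3 → 1 ≤ j → j ≤ m → A.bk (X i) (Y j) =
      if i = 0 ∧ j + 1 ≤ m then Y (j + 1) else 0) ∧
    (∀ i j : ℕ, 1 ≤ i → i ≤ m → 1 ≤ j → j ≤ m → A.bk (Y i) (Y j) =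
      if i = 1 ∧ j = 1 then X 2
      else if (i = 1 ∧ j = 2) ∨ (i = 2 ∧ j = 1) then (1/2 : ℂ) • X 3 else 0)

/-- The law `L^{3,m} + φ₁₂ + Ψ²₁₁` (additionally `[X₁,Y_j] = Y_{j+1}`). -/
def Law3mII {V : Type*} [AddCommGroup V] [Module ℂ V] (A : LieSuperAlg V) (m : ℕ) : Prop :=
  ∃ X Y : ℕ → V, A.IsAdaptedBasis 3 m X Y ∧
    (∀ i j : ℕ, i ≤ 3 → j ≤ 3 → A.bk (X i) (X j) =
      if i = 0 ∧ 1 ≤ j ∧ j ≤ 2 then X (j + 1)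
      else if j = 0 ∧ 1 ≤ i ∧ i ≤ 2 then -X (i + 1) else 0) ∧
    (∀ i j : ℕ, i ≤ 3 → 1 ≤ j → j ≤ m → A.bk (X i) (Y j) =
      if (i = 0 ∨ i = 1) ∧ j + 1 ≤ m then Y (j + 1) else 0) ∧
    (∀ i j : ℕ, 1 ≤ i → i ≤ m → 1 ≤ j → j ≤ m → A.bk (Y i) (Y j) =
      if i = 1 ∧ j = 1 then X 2
      else if (i = 1 ∧ j = 2) ∨ (i = 2 ∧ j = 1) then (1/2 : ℂ) • X 3 else 0)

namespace LieSuperAlg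

variable {V : Type*} [AddCommGroup V] [Module ℂ V] {A : LieSuperAlg V}

lemma ssign_zero_left (i : ZMod 2) : ssign 0 i = 1 := by simp [ssign]

lemma ssign_zero_right (i : ZMod 2) : ssign i 0 = 1 := by simp [ssign]

lemma ssign_mul_swap (i j : ZMod 2) : ssign i j * ssign j i = 1 := by
  unfold ssign
  split_ifs <;> simp_all

lemma bk_even_left (A : LieSuperAlg V) {a : ZMod 2} {x y : V} (hx : x ∈ A.g 0) (hy : y ∈ A.g a) :
    A.bk x y = -A.bk y x := by
  rw [A.skew 0 a x hx y hy, ssign_zero_left, one_smul]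

lemma bk_even_self (A : LieSuperAlg V) {x : V} (hx : x ∈ A.g 0) : A.bk x x = 0 := by
  have h : (2 : ℂ) • A.bk x x = 0 :=
    (two_smul ℂ _).trans (eq_neg_iff_add_eq_zero.mp (A.bk_even_left hx hx))
  exact (smul_eq_zero.mp h).resolve_left two_ne_zero

lemma bk_odd_comm (A : LieSuperAlg V) {x y : V} (hx : x ∈ A.g 1) (hy : y ∈ A.g 1) :
    A.bk x y = A.bk y x := by
  rw [A.skew 1 1 x hx y hy]
  simp [ssign]

/-- Bracketing with an even element is a derivation. -/
lemma bk_even_bk (A : LieSuperAlg V) {b c : ZMod 2} {x y z : V} (hx : x ∈ A.g 0)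
    (hy : y ∈ A.g b) (hz : z ∈ A.g c) :
    A.bk x (A.bk y z) = A.bk (A.bk x y) z + A.bk y (A.bk x z) := by
  have hxy : A.bk x y ∈ A.g b := by simpa using A.grading 0 b x hx y hy
  have hj := A.jacobi 0 b c x hx y hy z hz
  rw [ssign_zero_left, ssign_zero_right, A.skew c 0 z hz x hx, ssign_zero_right,
    A.skew c b z hz _ hxy, smul_neg, smul_smul, ssign_mul_swap] at hj
  simp only [one_smul, map_neg] at hj
  refine sub_eq_zero.mp (Eq.trans ?_ hj)
  abel

lemma odd_jacobi (A : LieSuperAlg V) {x y z : V} (hx : x ∈ A.g 1) (hy : y ∈ A.g 1)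
    (hz : z ∈ A.g 1) :
    A.bk x (A.bk y z) + A.bk y (A.bk z x) + A.bk z (A.bk x y) = 0 := by
  have hj := A.jacobi 1 1 1 x hx y hy z hz
  simp only [ssign, and_self, if_true, neg_smul, one_smul] at hj
  refine neg_eq_zero.mp (Eq.trans ?_ hj)
  abel

lemma bk_mem_C {a : ZMod 2} {k : ℕ} {x y : V} (hx : x ∈ A.g 0) (hy : y ∈ A.C a k) :
    A.bk x y ∈ A.C a (k + 1) :=
  Submodule.subset_span ⟨x, hx, y, hy, rfl⟩

lemma C_le_g (A : LieSuperAlg V) (a : ZMod 2) : ∀ k, A.C a k ≤ A.g a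
  | 0 => le_rfl
  | k + 1 => by
    refine Submodule.span_le.mpr ?_
    rintro _ ⟨x, hx, y, hy, rfl⟩
    simpa using A.grading 0 a x hx y (A.C_le_g a k hy)

lemma C_succ_mono {a : ZMod 2} {k l : ℕ} (h : A.C a k ≤ A.C a l) :
    A.C a (k + 1) ≤ A.C a (l + 1) :=
  Submodule.span_mono fun _ ⟨x, hx, y, hy, e⟩ => ⟨x, hx, y, h hy, e⟩

lemma C_succ_le (A : LieSuperAlg V) (a : ZMod 2) : ∀ k, A.C a (k + 1) ≤ A.C a k
  | 0 => A.C_le_g a 1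
  | k + 1 => C_succ_mono (A.C_succ_le a k)

lemma C_antitone (A : LieSuperAlg V) (a : ZMod 2) : Antitone (A.C a) :=
  antitone_nat_of_succ_le (A.C_succ_le a)

lemma C_le_add_of_le_succ {a : ZMod 2} {k : ℕ} (h : A.C a k ≤ A.C a (k + 1)) (n : ℕ) :
    A.C a k ≤ A.C a (k + n) := by
  have hstep : ∀ n, A.C a (k + n) ≤ A.C a (k + n + 1) := by
    intro n
    induction n with
    | zero => exact h
    | succ n ih => exact C_succ_mono ih
  induction n with
  | zero => exact le_rfl
  | succ n ih => exact ih.trans (hstep n)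

/-- The descending sequence is strictly decreasing until it vanishes. -/
lemma not_C_le_C_succ {a : ZMod 2} {N k : ℕ} (hN : A.C a N ≠ ⊥) (hN' : A.C a (N + 1) = ⊥)
    (hk : k ≤ N) : ¬ A.C a k ≤ A.C a (k + 1) := by
  intro h
  have h₁ := C_le_add_of_le_succ h (N + 1 - k)
  rw [show k + (N + 1 - k) = N + 1 by omega, hN', le_bot_iff] at h₁
  exact hN (le_bot_iff.mp (h₁ ▸ A.C_antitone a hk))

/-- `W` splits the descending sequences of `A` compatibly with the bracket. -/
structure IsGradedBy (A : LieSuperAlg V) (W : ZMod 2 → ℕ → Submodule ℂ V) : Prop where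
  sup_eq : ∀ a k, A.C a k = W a (k + 1) ⊔ A.C a (k + 1)
  inf_eq : ∀ a k, W a (k + 1) ⊓ A.C a (k + 1) = ⊥
  bk_mem : ∀ a b : ZMod 2, ∀ i j : ℕ, ∀ x ∈ W a i, ∀ y ∈ W b j, A.bk x y ∈ W (a + b) (i + j)

lemma bk_C_one_mem {a : ZMod 2} {k : ℕ} {x y : V} (hx : x ∈ A.C 0 1) (hy : y ∈ A.C a k) :
    A.bk x y ∈ A.C a (k + 2) := by
  induction hx using Submodule.span_induction with
  | mem x h =>
    obtain ⟨p, hp, q, hq, rfl⟩ := h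
    have h₁ := A.bk_even_bk hp hq (A.C_le_g a k hy)
    rw [show A.bk (A.bk p q) y = A.bk p (A.bk q y) - A.bk q (A.bk p y) by rw [h₁]; abel]
    exact sub_mem (bk_mem_C hp (bk_mem_C hq hy)) (bk_mem_C hq (bk_mem_C hp hy))
  | zero => simp
  | add x y _ _ h₁ h₂ => simpa using add_mem h₁ h₂
  | smul c x _ h => simpa using Submodule.smul_mem _ c h

namespace IsGradedBy

variable {W : ZMod 2 → ℕ → Submodule ℂ V}

lemma le_C (hW : A.IsGradedBy W) (a : ZMod 2) (k : ℕ) : W a (k + 1) ≤ A.C a k :=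
  hW.sup_eq a k ▸ le_sup_left

lemma mem_g (hW : A.IsGradedBy W) {a : ZMod 2} {k : ℕ} {x : V} (hx : x ∈ W a (k + 1)) : x ∈ A.g a :=
  A.C_le_g a k (hW.le_C a k hx)

lemma eq_zero_of_C_eq_bot (hW : A.IsGradedBy W) {a : ZMod 2} {N k : ℕ} {x : V}
    (hN : A.C a N = ⊥) (hk : N ≤ k)
    (hx : x ∈ W a (k + 1)) : x = 0 := by
  have := A.C_antitone a hk (hW.le_C a k hx)
  rwa [hN, Submodule.mem_bot] at this

lemma bk_eq_zero_of_C_eq_bot (hW : A.IsGradedBy W) {a b : ZMod 2} {N i j : ℕ} {x y : V}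
    (hN : A.C (a + b) N = ⊥) (hij : N < i + j) (hx : x ∈ W a i) (hy : y ∈ W b j) : A.bk x y = 0 := by
  have h := hW.bk_mem a b i j x hx y hy
  obtain ⟨k, hk⟩ : ∃ k, i + j = k + 1 := ⟨i + j - 1, by omega⟩
  rw [hk] at h
  exact hW.eq_zero_of_C_eq_bot hN (by omega) h

/-- Each step of the descending sequence is already produced by the lowest graded parts. -/
lemma exists_bk_ne_zero (hW : A.IsGradedBy W) {a : ZMod 2} {k : ℕ} (h : ¬ A.C a (k + 1) ≤ A.C a (k + 2)) :
    ∃ v ∈ W 0 1, ∃ y ∈ W a (k + 1), A.bk v y ≠ 0 := by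
  by_contra! h₀
  refine h (Submodule.span_le.mpr ?_)
  rintro _ ⟨x, hx, y, hy, rfl⟩
  rw [show A.g 0 = A.C 0 0 from rfl, hW.sup_eq 0 0] at hx
  obtain ⟨v, hv, c, hc, rfl⟩ := Submodule.mem_sup.mp hx
  have hcy := bk_C_one_mem hc hy
  rw [hW.sup_eq a k] at hy
  obtain ⟨w, hw, d, hd, rfl⟩ := Submodule.mem_sup.mp hy
  have hvd : A.bk v d ∈ A.C a (k + 2) := bk_mem_C (hW.mem_g hv) hd
  rw [A.bk.map_add, LinearMap.add_apply, (A.bk v).map_add, h₀ v hv w hw, zero_add]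
  exact add_mem hvd hcy

variable [FiniteDimensional ℂ V]

lemma finrank_C (hW : A.IsGradedBy W) (a : ZMod 2) (k : ℕ) : Module.finrank ℂ (A.C a k) =
    Module.finrank ℂ (W a (k + 1)) + Module.finrank ℂ (A.C a (k + 1)) := by
  rw [← Submodule.finrank_sup_add_finrank_inf_eq, hW.inf_eq, ← hW.sup_eq, finrank_bot, add_zero]

lemma finrank_pos (hW : A.IsGradedBy W) {a : ZMod 2} {k : ℕ} (h : ¬ A.C a k ≤ A.C a (k + 1)) :
    0 < Module.finrank ℂ (W a (k + 1)) := by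
  by_contra! h₀
  have h₁ : W a (k + 1) = ⊥ := Submodule.finrank_eq_zero.mp (by omega)
  apply h
  conv_lhs => rw [hW.sup_eq, h₁, bot_sup_eq]

/-- If the descending sequence of `A.g a` has maximal length then its graded parts are lines. -/
lemma finrank_eq_one (hW : A.IsGradedBy W) {a : ZMod 2} {N : ℕ} (hN : A.C a N ≠ ⊥) (hN' : A.C a (N + 1) = ⊥)
    (hd : Module.finrank ℂ (A.g a) = N + 1) {k : ℕ} (hk : k ≤ N) :
    Module.finrank ℂ (W a (k + 1)) = 1 := by
  have hpos : ∀ k ≤ N, 0 < Module.finrank ℂ (W a (k + 1)) := fun k hk =>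
    hW.finrank_pos (not_C_le_C_succ hN hN' hk)
  have hup : ∀ k ≤ N + 1, Module.finrank ℂ (A.C a k) + k ≤ N + 1 := by
    intro k
    induction k with
    | zero => intro _; exact hd.le
    | succ k ih =>
      intro hk
      have := ih (by omega)
      have := hW.finrank_C a k
      have := hpos k (by omega)
      omega
  have hdown : ∀ j ≤ N + 1, j ≤ Module.finrank ℂ (A.C a (N + 1 - j)) := by
    intro j
    induction j with
    | zero => simp
    | succ j ih =>
      intro hj
      have h₁ := ih (by omega)
      have h₂ := hW.finrank_C a (N + 1 - (j + 1))
      rw [show N + 1 - (j + 1) + 1 = N + 1 - j by omega] at h₂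
      have h₃ := hpos (N + 1 - (j + 1)) (by omega)
      rw [show N + 1 - (j + 1) + 1 = N + 1 - j by omega] at h₃
      omega
  have h₁ := hup k (by omega)
  have h₂ := hdown (N - k) (by omega)
  rw [show N + 1 - (N - k) = k + 1 by omega] at h₂
  have h₃ := hW.finrank_C a k
  have h₄ := hpos k hk
  omega

end IsGradedBy

lemma linearIndependent_pair_of_bk_ne_zero {x y : V} (hx : x ∈ A.g 0) (hy : y ∈ A.g 0)
    (h : A.bk x y ≠ 0) : LinearIndependent ℂ ![x, y] := by
  refine LinearIndependent.pair_iff.mpr fun s t hst => ?_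
  have h₁ := congrArg (A.bk x) hst
  have h₂ := congrArg (fun z => A.bk z y) hst
  simp only [map_add, map_smul, map_zero, LinearMap.add_apply, LinearMap.smul_apply,
    LinearMap.zero_apply, A.bk_even_self hx, A.bk_even_self hy, smul_zero, zero_add,
    add_zero] at h₁ h₂
  exact ⟨(smul_eq_zero.mp h₂).resolve_right h, (smul_eq_zero.mp h₁).resolve_right h⟩

lemma finrank_span_pair_of_bk_ne_zero {x y : V} (hx : x ∈ A.g 0) (hy : y ∈ A.g 0)
    (h : A.bk x y ≠ 0) : Module.finrank ℂ (Submodule.span ℂ {x, y}) = 2 := by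
  have := finrank_span_eq_card (linearIndependent_pair_of_bk_ne_zero hx hy h)
  rwa [Matrix.range_cons_cons_empty] at this

end LieSuperAlg

lemma Submodule.exists_smul_eq_of_finrank_eq_one {K V : Type*} [Field K] [AddCommGroup V]
    [Module K V] {U : Submodule K V} (hU : Module.finrank K U = 1) {x y : V} (hx : x ∈ U)
    (hx₀ : x ≠ 0) (hy : y ∈ U) : ∃ c : K, y = c • x := by
  obtain ⟨c, hc⟩ := _root_.exists_smul_eq_of_finrank_eq_one hU (x := ⟨x, hx⟩)
    (by simpa [Subtype.ext_iff] using hx₀) ⟨y, hy⟩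
  exact ⟨c, (congrArg Subtype.val hc).symm⟩

/-- Finitely many linear maps, none vanishing on the subspace `U`, have a common
non-zero in `U`. -/
lemma Submodule.exists_mem_forall_apply_ne_zero {K V V' ι : Type*} [Field K] [Infinite K]
    [AddCommGroup V] [Module K V] [AddCommGroup V'] [Module K V'] [Finite ι] (U : Submodule K V)
    (f : ι → V →ₗ[K] V') (hf : ∀ i, ∃ v ∈ U, f i v ≠ 0) : ∃ v ∈ U, ∀ i, f i v ≠ 0 := by
  by_contra! h
  obtain ⟨i, hi⟩ := Subspace.exists_eq_top_of_iUnion_eq_univ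
    (p := fun i => LinearMap.ker ((f i).domRestrict U)) (by
      refine Set.eq_univ_of_forall fun v => ?_
      obtain ⟨i, hi⟩ := h v v.2
      exact Set.mem_iUnion.mpr ⟨i, hi⟩)
  obtain ⟨v, hv, hne⟩ := hf i
  have : (⟨v, hv⟩ : U) ∈ LinearMap.ker ((f i).domRestrict U) := hi ▸ Submodule.mem_top
  exact hne this

namespace LieSuperAlg

variable {V : Type*} [AddCommGroup V] [Module ℂ V] {A : LieSuperAlg V}

namespace IsGradedBy

variable {W : ZMod 2 → ℕ → Submodule ℂ V} [FiniteDimensional ℂ V] {m : ℕ}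

lemma finrank_even (hW : A.IsGradedBy W) (hfil : A.IsFiliform 3 m) :
    Module.finrank ℂ (W 0 1) = 2 ∧ Module.finrank ℂ (W 0 2) = 1 ∧
      Module.finrank ℂ (W 0 3) = 1 := by
  obtain ⟨-, hd, -, hC, -, hC', -⟩ := hfil
  have hlt := fun k hk => not_C_le_C_succ (k := k) hC hC' hk
  obtain ⟨u, hu, v, hv, huv⟩ := hW.exists_bk_ne_zero (hlt 1 (by norm_num))
  have h₁ : Module.finrank ℂ (Submodule.span ℂ {u, v}) ≤ Module.finrank ℂ (W 0 1) :=
    Submodule.finrank_mono (Submodule.span_le.mpr (by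
      rintro _ (rfl | rfl)
      exacts [hu, hv]))
  rw [finrank_span_pair_of_bk_ne_zero (hW.mem_g hu) (hW.mem_g hv) huv] at h₁
  have h₂ : 0 < Module.finrank ℂ (W 0 2) := hW.finrank_pos (hlt 1 (by norm_num))
  have h₃ : 0 < Module.finrank ℂ (W 0 3) := hW.finrank_pos (hlt 2 (by norm_num))
  have e₁ : 3 + 1 = Module.finrank ℂ (W 0 1) + Module.finrank ℂ (A.C 0 1) :=
    hd.symm.trans (hW.finrank_C 0 0)
  have e₂ : Module.finrank ℂ (A.C 0 1) =
    Module.finrank ℂ (W 0 2) + Module.finrank ℂ (A.C 0 2) := hW.finrank_C 0 1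
  have e₃ : Module.finrank ℂ (A.C 0 2) =
    Module.finrank ℂ (W 0 3) + Module.finrank ℂ (A.C 0 3) := hW.finrank_C 0 2
  omega

/-- Generic homogeneous generators of degree one. -/
lemma exists_generators (hW : A.IsGradedBy W) (hfil : A.IsFiliform 3 m) (hm : 1 ≤ m) :
    ∃ X₀ ∈ W 0 1, ∃ X₁ ∈ W 0 1, ∃ Y₁ ∈ W 1 1, A.bk X₀ X₁ ≠ 0 ∧ A.bk X₀ (A.bk X₀ X₁) ≠ 0 ∧
      A.bk X₁ (A.bk X₀ X₁) = 0 ∧ ∀ j < m, ((A.bk X₀) ^ j) Y₁ ≠ 0 := by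
  obtain ⟨-, d₂, d₃⟩ := hW.finrank_even hfil
  obtain ⟨-, -, hd, hC, hD, hC', hD'⟩ := hfil
  have hlt := fun k hk => not_C_le_C_succ (k := k) hC hC' hk
  obtain ⟨N, rfl⟩ : ∃ N, m = N + 1 := ⟨m - 1, by omega⟩
  rw [Nat.add_sub_cancel] at hD
  obtain ⟨u, hu, v, hv, huv⟩ := hW.exists_bk_ne_zero (hlt 1 (by norm_num))
  obtain ⟨u', hu', z, hz, huz⟩ := hW.exists_bk_ne_zero (hlt 2 (by norm_num))
  have hodd : ∀ k : Fin N, ∃ w ∈ W 0 1, ∃ y ∈ W 1 (k.val + 1), A.bk w y ≠ 0 := fun k =>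
    hW.exists_bk_ne_zero (not_C_le_C_succ hD hD' (by omega))
  choose w hw y hy hwy using hodd
  obtain ⟨X₀, hX₀, hne⟩ := (W 0 1).exists_mem_forall_apply_ne_zero
    (fun i => A.bk.flip (Sum.elim ![v, z] y i)) (by
      rintro (i | i)
      · fin_cases i
        exacts [⟨u, hu, huv⟩, ⟨u', hu', huz⟩]
      · exact ⟨w i, hw i, hwy i⟩)
  have hXv : A.bk X₀ v ≠ 0 := hne (Sum.inl 0)
  have hXz : A.bk X₀ z ≠ 0 := hne (Sum.inl 1)
  have hXy : ∀ k, A.bk X₀ (y k) ≠ 0 := fun k => hne (Sum.inr k)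
  have hz₀ : z ≠ 0 := by
    rintro rfl
    simp at hXz
  obtain ⟨t, ht⟩ := Submodule.exists_smul_eq_of_finrank_eq_one d₃ (hW.bk_mem 0 0 1 2 _ hX₀ _ hz)
    hXz (hW.bk_mem 0 0 1 2 _ hv _ hz)
  have hX₁ : A.bk X₀ (v - t • X₀) = A.bk X₀ v := by
    rw [map_sub, map_smul, A.bk_even_self (hW.mem_g hX₀), smul_zero, sub_zero]
  have hX₁z : A.bk (v - t • X₀) z = 0 := by
    rw [map_sub, map_smul, LinearMap.sub_apply, LinearMap.smul_apply, ht, sub_self]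
  obtain ⟨c, hc⟩ := Submodule.exists_smul_eq_of_finrank_eq_one d₂ hz hz₀
    (hW.bk_mem 0 0 1 1 _ hX₀ _ hv)
  have hc₀ : c ≠ 0 := by
    rintro rfl
    exact hXv (by simpa using hc)
  have hW₁ := hW.finrank_eq_one hD hD' hd (Nat.zero_le N)
  obtain ⟨Y₁, hY₁, hY₀⟩ := (W 1 1).exists_mem_ne_zero_of_ne_bot (by
    intro h
    rw [zero_add, h, finrank_bot] at hW₁
    exact zero_ne_one hW₁)
  have hY : ∀ j < N + 1, ((A.bk X₀) ^ j) Y₁ ∈ W 1 (j + 1) ∧ ((A.bk X₀) ^ j) Y₁ ≠ 0 := by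
    intro j
    induction j with
    | zero => intro _; exact ⟨hY₁, hY₀⟩
    | succ j ih =>
      intro hj
      obtain ⟨hmem, hj₀⟩ := ih (by omega)
      rw [pow_succ', Module.End.mul_apply]
      refine ⟨?_, fun h => ?_⟩
      · have := hW.bk_mem 0 1 1 (j + 1) _ hX₀ _ hmem
        rwa [zero_add, add_comm 1 (j + 1)] at this
      · obtain ⟨s, hs⟩ := Submodule.exists_smul_eq_of_finrank_eq_one
          (hW.finrank_eq_one hD hD' hd (k := j) (by omega)) hmem hj₀ (hy ⟨j, by omega⟩)
        apply hXy ⟨j, by omega⟩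
        rw [hs, map_smul, h, smul_zero]
  refine ⟨X₀, hX₀, v - t • X₀, sub_mem hv (Submodule.smul_mem _ _ hX₀), Y₁, hY₁, ?_, ?_, ?_,
    fun j hj => (hY j hj).2⟩
  · rwa [hX₁]
  · rw [hX₁, hc, map_smul]
    exact smul_ne_zero hc₀ hXz
  · rw [hX₁, hc, map_smul, hX₁z, smul_zero]

end IsGradedBy

end LieSuperAlg

namespace LieSuperAlg

variable {V : Type*} [AddCommGroup V] [Module ℂ V] {A : LieSuperAlg V}

namespace IsGradedBy

variable {W : ZMod 2 → ℕ → Submodule ℂ V} {m : ℕ}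

lemma g_le (hW : A.IsGradedBy W) {a : ZMod 2} {N : ℕ} {S : Submodule ℂ V} (hN : A.C a N = ⊥)
    (hS : ∀ k < N, W a (k + 1) ≤ S) : A.g a ≤ S := by
  have h : ∀ j ≤ N, A.C a (N - j) ≤ S := by
    intro j
    induction j with
    | zero => intro _; simp [hN]
    | succ j ih =>
      intro hj
      rw [hW.sup_eq]
      refine sup_le (hS _ (by omega)) ?_
      rw [show N - (j + 1) + 1 = N - j by omega]
      exact ih (by omega)
  simpa [C] using h N le_rfl

lemma odd_bk_eq_zero (hW : A.IsGradedBy W) (hC : A.C 0 3 = ⊥) {y : ℕ → V}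
    (hy : ∀ j, y j ∈ W 1 (j + 1)) {i j : ℕ} (hij : 2 ≤ i + j) : A.bk (y i) (y j) = 0 :=
  hW.bk_eq_zero_of_C_eq_bot (a := 1) (b := 1) (N := 3) hC (by omega) (hy i) (hy j)

lemma bk_odd_zero_one (hW : A.IsGradedBy W) {X₀ : V} (hX₀ : X₀ ∈ W 0 1) {y : ℕ → V}
    (hy : ∀ j, y j ∈ W 1 (j + 1)) (hy_succ : ∀ j, A.bk X₀ (y j) = y (j + 1)) :
    A.bk (y 0) (y 1) = (1 / 2 : ℂ) • A.bk X₀ (A.bk (y 0) (y 0)) := by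
  have hyg : ∀ j, y j ∈ A.g 1 := fun j => hW.mem_g (hy j)
  rw [A.bk_even_bk (hW.mem_g hX₀) (hyg 0) (hyg 0), hy_succ, A.bk_odd_comm (hyg (0 + 1)) (hyg 0),
    ← two_smul ℂ, smul_smul]
  norm_num

section

variable [FiniteDimensional ℂ V]

lemma basis_span_eq_top (hW : A.IsGradedBy W) (hfil : A.IsFiliform 3 m) {X y : ℕ → V}
    (h₀ : X 0 ∈ W 0 1) (h₁ : X 1 ∈ W 0 1) (h₂ : A.bk (X 0) (X 1) = X 2)
    (h₃ : A.bk (X 0) (X 2) = X 3) (h₃₀ : X 3 ≠ 0) (hy : ∀ j, y j ∈ W 1 (j + 1))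
    (hy₀ : ∀ j < m, y j ≠ 0) :
    Submodule.span ℂ (Set.range
      (Sum.elim (fun i : Fin 4 => X i.val) (fun j : Fin m => y j.val))) = ⊤ := by
  set S := Submodule.span ℂ (Set.range
    (Sum.elim (fun i : Fin 4 => X i.val) (fun j : Fin m => y j.val)))
  have hXS : ∀ i < 4, X i ∈ S := fun i hi => Submodule.subset_span ⟨Sum.inl ⟨i, hi⟩, rfl⟩
  have hyS : ∀ j < m, y j ∈ S := fun j hj => Submodule.subset_span ⟨Sum.inr ⟨j, hj⟩, rfl⟩
  have hX₂ : X 2 ≠ 0 := by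
    intro h
    rw [h, map_zero] at h₃
    exact h₃₀ h₃.symm
  have hline : ∀ {U : Submodule ℂ V} {x : V}, Module.finrank ℂ U = 1 → x ∈ U → x ≠ 0 →
      x ∈ S → U ≤ S := by
    intro U x hU hx hx₀ hxS z hz
    obtain ⟨c, rfl⟩ := Submodule.exists_smul_eq_of_finrank_eq_one hU hx hx₀ hz
    exact S.smul_mem c hxS
  obtain ⟨d₁, d₂, d₃⟩ := hW.finrank_even hfil
  obtain ⟨-, -, hd, -, hD, hC', hD'⟩ := hfil
  have hX₂W : X 2 ∈ W 0 2 := h₂ ▸ hW.bk_mem 0 0 1 1 _ h₀ _ h₁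
  have hX₃W : X 3 ∈ W 0 3 := h₃ ▸ hW.bk_mem 0 0 1 2 _ h₀ _ hX₂W
  have heven : A.g 0 ≤ S := by
    refine hW.g_le hC' fun k hk => ?_
    interval_cases k
    · have hspan : Submodule.span ℂ {X 0, X 1} = W 0 1 := by
        refine Submodule.eq_of_le_of_finrank_le (Submodule.span_le.mpr ?_) ?_
        · rintro _ (rfl | rfl)
          exacts [h₀, h₁]
        · rw [d₁, finrank_span_pair_of_bk_ne_zero (hW.mem_g h₀) (hW.mem_g h₁) (h₂ ▸ hX₂)]
      rw [zero_add, ← hspan, Submodule.span_le]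
      rintro _ (rfl | rfl)
      exacts [hXS 0 (by norm_num), hXS 1 (by norm_num)]
    · exact hline d₂ hX₂W hX₂ (hXS 2 (by norm_num))
    · exact hline d₃ hX₃W h₃₀ (hXS 3 (by norm_num))
  have hodd : A.g 1 ≤ S := by
    refine hW.g_le hD' fun k hk => ?_
    have hm : m - 1 + 1 = m := by omega
    exact hline (hW.finrank_eq_one hD (by rwa [hm]) (by rwa [hm]) (by omega)) (hy k) (hy₀ k hk)
      (hyS k hk)
  exact top_le_iff.mp (A.compl.sup_eq_top ▸ sup_le heven hodd)

/-- In a normalised homogeneous basis every even generator but `X₀` kills the odd part. -/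
lemma bk_odd_eq_zero (hW : A.IsGradedBy W) (hfil : A.IsFiliform 3 m) (hm : 5 ≤ m) {X y : ℕ → V}
    (h₀ : X 0 ∈ W 0 1) (h₁ : X 1 ∈ W 0 1) (h₂ : A.bk (X 0) (X 1) = X 2)
    (h₃ : A.bk (X 0) (X 2) = X 3) (h₁₂ : A.bk (X 1) (X 2) = 0) (h₃₀ : X 3 ≠ 0)
    (hy : ∀ j, y j ∈ W 1 (j + 1)) (hy_succ : ∀ j, A.bk (X 0) (y j) = y (j + 1))
    (hy₀ : ∀ j < m, y j ≠ 0) (hyy : A.bk (y 0) (y 0) = X 2) (j : ℕ) :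
    A.bk (X 1) (y j) = 0 ∧ A.bk (X 2) (y j) = 0 ∧ A.bk (X 3) (y j) = 0 := by
  obtain ⟨-, -, hd, -, hD, hC', hD'⟩ := hfil
  have hyg : ∀ j, y j ∈ A.g 1 := fun j => hW.mem_g (hy j)
  have hX₂W : X 2 ∈ W 0 2 := h₂ ▸ hW.bk_mem 0 0 1 1 _ h₀ _ h₁
  have hX₃W : X 3 ∈ W 0 3 := h₃ ▸ hW.bk_mem 0 0 1 2 _ h₀ _ hX₂W
  have g₀ := hW.mem_g h₀
  have g₁ := hW.mem_g h₁
  have g₂ := hW.mem_g hX₂W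
  have g₃ := hW.mem_g hX₃W
  have hline : ∀ k < m, ∀ z ∈ W 1 (k + 1), ∃ c : ℂ, z = c • y k := by
    intro k hk z hz
    have hm' : m - 1 + 1 = m := by omega
    exact Submodule.exists_smul_eq_of_finrank_eq_one
      (hW.finrank_eq_one hD (by rwa [hm']) (by rwa [hm']) (by omega)) (hy k) (hy₀ k hk) hz
  have hy₀₁ : A.bk (y 0) (y 1) = (1 / 2 : ℂ) • X 3 := by
    rw [hW.bk_odd_zero_one h₀ hy hy_succ, hyy, h₃]
  have hy₁₀ : A.bk (y 1) (y 0) = (1 / 2 : ℂ) • X 3 := by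
    rw [A.bk_odd_comm (hyg 1) (hyg 0), hy₀₁]
  have hX₂ : ∀ j, A.bk (X 2) (y j) = 0 := by
    have hge : ∀ j, 2 ≤ j → A.bk (X 2) (y j) = 0 := by
      intro j hj
      have h := A.odd_jacobi (hyg 0) (hyg 0) (hyg j)
      rw [hyy, hW.odd_bk_eq_zero hC' hy (i := 0) (j := j) (by omega),
        hW.odd_bk_eq_zero hC' hy (i := j) (j := 0) (by omega), map_zero, zero_add, zero_add] at h
      rw [A.bk_even_left g₂ (hyg j), h, neg_zero]
    intro j
    rcases lt_or_ge j 2 with hj | hj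
    · interval_cases j
      · have h := A.odd_jacobi (hyg 0) (hyg 0) (hyg 0)
        rw [hyy] at h
        have h' : (3 : ℂ) • A.bk (y 0) (X 2) = 0 := by
          rw [← h]
          module
        rw [A.bk_even_left g₂ (hyg 0), (smul_eq_zero.mp h').resolve_left three_ne_zero, neg_zero]
      · have h := A.odd_jacobi (hyg 0) (hyg 1) (hyg 1)
        rw [hW.odd_bk_eq_zero hC' hy (i := 1) (j := 1) (by omega), hy₀₁, hy₁₀, map_zero, zero_add,
          map_smul, ← add_smul] at h
        have h₃₁ : A.bk (X 3) (y 1) = 0 := by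
          rw [A.bk_even_left g₃ (hyg 1), (smul_eq_zero.mp h).resolve_left (by norm_num), neg_zero]
        obtain ⟨c, hc⟩ := hline 3 (by omega) _ (hW.bk_mem 0 1 2 2 _ hX₂W _ (hy 1))
        have h' := A.bk_even_bk g₀ g₂ (hyg 1)
        rw [h₃, h₃₁, hy_succ, hge (1 + 1) le_rfl, hc, map_smul, hy_succ, add_zero] at h'
        rw [hc, (smul_eq_zero.mp h').resolve_right (hy₀ 4 (by omega)), zero_smul]
    · exact hge j hj
  have hX₁ : ∀ j, A.bk (X 1) (y j) = 0 := by
    intro j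
    induction j with
    | zero =>
      obtain ⟨c, hc⟩ := hline 1 (by omega) _ (hW.bk_mem 0 1 1 1 _ h₁ _ (hy 0))
      have h := A.bk_even_bk g₁ (hyg 0) (hyg 0)
      rw [hyy, h₁₂, hc, map_smul, map_smul, LinearMap.smul_apply, hy₁₀, hy₀₁, ← smul_add,
        ← add_smul, smul_smul] at h
      have := (smul_eq_zero.mp h.symm).resolve_right h₃₀
      norm_num at this
      rw [hc, this, zero_smul]
    | succ j ih =>
      have h := A.bk_even_bk g₀ g₁ (hyg j)
      rwa [ih, h₂, hX₂, map_zero, zero_add, hy_succ, eq_comm] at h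
  refine ⟨hX₁ j, hX₂ j, ?_⟩
  have h := A.bk_even_bk g₀ g₂ (hyg j)
  rwa [hX₂, h₃, hy_succ, hX₂, map_zero, add_zero, eq_comm] at h

/-- A suitably scaled homogeneous basis. -/
lemma exists_normalised_basis (hW : A.IsGradedBy W) (hfil : A.IsFiliform 3 m) (hm : 5 ≤ m)
    (hnd : A.NonDegenerate) :
    ∃ X y : ℕ → V, X 0 ∈ W 0 1 ∧ X 1 ∈ W 0 1 ∧ A.bk (X 0) (X 1) = X 2 ∧
      A.bk (X 0) (X 2) = X 3 ∧ A.bk (X 1) (X 2) = 0 ∧ X 3 ≠ 0 ∧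
      (∀ j, y j ∈ W 1 (j + 1)) ∧ (∀ j, A.bk (X 0) (y j) = y (j + 1)) ∧
      (∀ j < m, y j ≠ 0) ∧ A.bk (y 0) (y 0) = X 2 := by
  obtain ⟨X₀, hX₀, X₁, hX₁, Y₁, hY₁, h₂, h₃, h₁₂, hY⟩ := hW.exists_generators hfil (by omega)
  set y : ℕ → V := fun j => ((A.bk X₀) ^ j) Y₁
  have hy_succ : ∀ j, A.bk X₀ (y j) = y (j + 1) := fun j => by
    simp only [y, pow_succ', Module.End.mul_apply]
  have hy : ∀ j, y j ∈ W 1 (j + 1) := by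
    intro j
    induction j with
    | zero => exact hY₁
    | succ j ih =>
      have := hW.bk_mem 0 1 1 (j + 1) _ hX₀ _ ih
      rwa [zero_add, add_comm 1 (j + 1), hy_succ] at this
  obtain ⟨b, hb⟩ := Submodule.exists_smul_eq_of_finrank_eq_one (hW.finrank_even hfil).2.1
    (hW.bk_mem 0 0 1 1 _ hX₀ _ hX₁) h₂ (hW.bk_mem 1 1 1 1 _ (hy 0) _ (hy 0))
  have hb₀ : b ≠ 0 := by
    rintro rfl
    rw [zero_smul] at hb
    have h₀₁ := hW.bk_odd_zero_one hX₀ hy hy_succ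
    rw [hb, map_zero, smul_zero] at h₀₁
    obtain ⟨-, -, hd, -, hD, hC', hD'⟩ := hfil
    have hyy : ∀ i j, A.bk (y i) (y j) = 0 := by
      intro i j
      rcases le_or_gt 2 (i + j) with hij | hij
      · exact hW.odd_bk_eq_zero hC' hy hij
      · obtain ⟨rfl, rfl⟩ | ⟨rfl, rfl⟩ | ⟨rfl, rfl⟩ :
            (i = 0 ∧ j = 0) ∨ (i = 0 ∧ j = 1) ∨ (i = 1 ∧ j = 0) := by omega
        · exact hb
        · exact h₀₁
        · rw [A.bk_odd_comm (hW.mem_g (hy 1)) (hW.mem_g (hy 0)), h₀₁]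
    have hspan : ∀ {S : Submodule ℂ V}, (∀ j, y j ∈ S) → A.g 1 ≤ S := by
      intro S hS
      refine hW.g_le hD' fun k hk z hz => ?_
      have hm' : m - 1 + 1 = m := by omega
      obtain ⟨c, rfl⟩ := Submodule.exists_smul_eq_of_finrank_eq_one
        (hW.finrank_eq_one hD (by rwa [hm']) (by rwa [hm']) (by omega)) (hy k) (hY k hk) hz
      exact S.smul_mem c (hS k)
    obtain ⟨p, hp, q, hq, hpq⟩ := hnd
    have hq' : ∀ i, A.bk (y i) q = 0 := fun i =>
      hspan (S := LinearMap.ker (A.bk (y i))) (hyy i) hq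
    exact hpq (hspan (S := LinearMap.ker (A.bk.flip q)) hq' hp)
  refine ⟨fun | 0 => X₀ | 1 => b • X₁ | 2 => b • A.bk X₀ X₁ | _ => b • A.bk X₀ (A.bk X₀ X₁), y,
    hX₀, Submodule.smul_mem _ _ hX₁, map_smul _ _ _, map_smul _ _ _, ?_, smul_ne_zero hb₀ h₃,
    hy, hy_succ, hY, hb⟩
  simp [h₁₂]

end

end IsGradedBy

end LieSuperAlg

lemma law3mI_of_isGradedBy {V : Type*} [AddCommGroup V] [Module ℂ V] [FiniteDimensional ℂ V]
    {A : LieSuperAlg V} {W : ZMod 2 → ℕ → Submodule ℂ V} {m : ℕ} (hm : 5 ≤ m)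
    (hfil : A.IsFiliform 3 m) (hnd : A.NonDegenerate) (hW : A.IsGradedBy W) : Law3mI A m := by
  obtain ⟨X, y, h₀, h₁, h₂, h₃, h₁₂, h₃₀, hy, hy_succ, hy₀, hyy⟩ :=
    hW.exists_normalised_basis hfil hm hnd
  have hXy := hW.bk_odd_eq_zero hfil hm h₀ h₁ h₂ h₃ h₁₂ h₃₀ hy hy_succ hy₀ hyy
  have hspan := hW.basis_span_eq_top hfil h₀ h₁ h₂ h₃ h₃₀ hy hy₀
  have hy₀₁ := hW.bk_odd_zero_one h₀ hy hy_succ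
  rw [hyy, h₃] at hy₀₁
  obtain ⟨-, hd₀, hd₁, -, -, hC', hD'⟩ := hfil
  have hyg : ∀ j, y j ∈ A.g 1 := fun j => hW.mem_g (hy j)
  have w₂ : X 2 ∈ W 0 2 := h₂ ▸ hW.bk_mem 0 0 1 1 _ h₀ _ h₁
  have w₃ : X 3 ∈ W 0 3 := h₃ ▸ hW.bk_mem 0 0 1 2 _ h₀ _ w₂
  have g₀ := hW.mem_g h₀
  have g₁ := hW.mem_g h₁
  have g₂ := hW.mem_g w₂
  have g₃ := hW.mem_g w₃
  have hvan : ∀ {i j : ℕ} {u v : V}, 3 < i + j → u ∈ W 0 i → v ∈ W 0 j → A.bk u v = 0 :=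
    fun hij hu hv => hW.bk_eq_zero_of_C_eq_bot (a := 0) (b := 0) hC' hij hu hv
  have h₁₀ : A.bk (X 1) (X 0) = -X 2 := by rw [A.bk_even_left g₁ g₀, h₂]
  have h₂₀ : A.bk (X 2) (X 0) = -X 3 := by rw [A.bk_even_left g₂ g₀, h₃]
  have h₂₁ : A.bk (X 2) (X 1) = 0 := by rw [A.bk_even_left g₂ g₁, h₁₂, neg_zero]
  have h₀₃ : A.bk (X 0) (X 3) = 0 := hvan (by norm_num) h₀ w₃
  have h₁₃ : A.bk (X 1) (X 3) = 0 := hvan (by norm_num) h₁ w₃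
  have h₂₃ : A.bk (X 2) (X 3) = 0 := hvan (by norm_num) w₂ w₃
  have h₃₀' : A.bk (X 3) (X 0) = 0 := hvan (by norm_num) w₃ h₀
  have h₃₁ : A.bk (X 3) (X 1) = 0 := hvan (by norm_num) w₃ h₁
  have h₃₂ : A.bk (X 3) (X 2) = 0 := hvan (by norm_num) w₃ w₂
  refine ⟨X, fun j => y (j - 1), ⟨?_, fun j _ _ => hyg _, ?_, ?_⟩, ?_, ?_, ?_⟩
  · intro i hi
    interval_cases i
    exacts [g₀, g₁, g₂, g₃]
  · refine linearIndependent_of_top_le_span_of_card_eq_finrank hspan.ge ?_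
    rw [← Submodule.finrank_add_eq_of_isCompl A.compl, hd₀, hd₁]
    simp
  · exact hspan
  · intro i j hi hj
    interval_cases i <;> interval_cases j <;>
      simp [h₁₀, h₂₀, h₂₁, h₀₃, h₁₃, h₂₃, h₃₀', h₃₁, h₃₂, h₂, h₃, h₁₂, A.bk_even_self g₀,
        A.bk_even_self g₁, A.bk_even_self g₂, A.bk_even_self g₃]
  · intro i j hi hj hjm
    obtain ⟨j, rfl⟩ : ∃ k, j = k + 1 := ⟨j - 1, by omega⟩
    simp only [Nat.add_sub_cancel]
    interval_cases i
    · rw [hy_succ]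
      split_ifs with h
      · rfl
      · exact hW.eq_zero_of_C_eq_bot hD' (by omega) (hy (j + 1))
    · simpa using (hXy j).1
    · simpa using (hXy j).2.1
    · simpa using (hXy j).2.2
  · intro i j hi _ hj _
    obtain ⟨i, rfl⟩ : ∃ k, i = k + 1 := ⟨i - 1, by omega⟩
    obtain ⟨j, rfl⟩ : ∃ k, j = k + 1 := ⟨j - 1, by omega⟩
    simp only [Nat.add_sub_cancel]
    split_ifs with h h'
    · obtain ⟨rfl, rfl⟩ : i = 0 ∧ j = 0 := by omega
      exact hyy
    · obtain ⟨rfl, rfl⟩ | ⟨rfl, rfl⟩ : (i = 0 ∧ j = 1) ∨ (i = 1 ∧ j = 0) := by omega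
      · exact hy₀₁
      · rw [A.bk_odd_comm (hyg 1) (hyg 0), hy₀₁]
    · exact hW.odd_bk_eq_zero hC' hy (by omega)

/-- The products of `Law3mII` violate the super Jacobi identity on `X₁, Y₁, Y₁`. -/
lemma not_law3mII {V : Type*} [AddCommGroup V] [Module ℂ V] (A : LieSuperAlg V) {m : ℕ}
    (hm : 2 ≤ m) : ¬ Law3mII A m := by
  rintro ⟨X, Y, ⟨hX, hY, hli, -⟩, hXX, hXY, hYY⟩
  have h := A.bk_even_bk (hX 1 (by norm_num)) (hY 1 le_rfl (by omega)) (hY 1 le_rfl (by omega))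
  rw [hYY 1 1 le_rfl (by omega) le_rfl (by omega), hXY 1 1 (by norm_num) le_rfl (by omega)] at h
  simp only [and_self, if_true, or_true, true_and] at h
  rw [if_pos (by omega), hXX 1 2 (by norm_num) (by norm_num),
    hYY (1 + 1) 1 (by norm_num) (by omega) le_rfl (by omega),
    hYY 1 (1 + 1) le_rfl (by omega) (by norm_num) (by omega)] at h
  norm_num at h
  rw [← add_smul] at h
  norm_num at h
  exact hli.ne_zero (Sum.inl 3) h.symm

/-- Every non-degenerate naturally graded filiform Lie superalgebra with
`dim g₀ = 4` and `dim g₁ = m` as indicated is isomorphic to exactly one of the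
two non-isomorphic superalgebras `L^{3,m} + φ₁₂` and `L^{3,m} + φ₁₂ + Ψ²₁₁`. -/
theorem stmt5 {V : Type*} [AddCommGroup V] [Module ℂ V] [FiniteDimensional ℂ V] (A : LieSuperAlg V) (m : ℕ)
    (hm : 5 ≤ m)
    (hfil : A.IsFiliform 3 m) (hnd : A.NonDegenerate) (hng : A.NaturallyGraded) :
    (Law3mI A m ∨ Law3mII A m) ∧ ¬(Law3mI A m ∧ Law3mII A m) := by
  obtain ⟨W, -, hsup, hinf, hbk⟩ := hng
  exact ⟨Or.inl (law3mI_of_isGradedBy hm hfil hnd ⟨hsup, hinf, hbk⟩),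
    fun h => not_law3mII A (by omega) h.2⟩
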